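/- arXiv:2006.08210 — 7 statements merged into one kernel-verified Lean document; each statement's English description precedes it below -/
import Mathlib

section
/- (Theorem 1, Möbius = Einstein gyromidpoint.) Let c > 0, let b₁, …, b_N ∈ ℝⁿ satisfy c‖b_i‖² < 1, and let ν₁, …, ν_N be nonnegative reals with Σᵢ νᵢ > 0. Set nᵢ = 2bᵢ/(1 + c‖bᵢ‖²), γᵢ = 1/√(1 − c‖nᵢ‖²), and let n̄ = (Σᵢ νᵢγᵢnᵢ)/(Σᵢ νᵢγᵢ) be the Einstein gyromidpoint in the Klein model. Then n̄ = ū, where ū = (Σᵢ νᵢ λ^c_{bᵢ} bᵢ)/(Σᵢ νᵢ(λ^c_{bᵢ} − 1)); moreover c‖ū‖² < 1, so the Klein-to-Poincaré projection n̄/(1 + √(1 − c‖n̄‖²)) of the Einstein gyromidpoint equals the Möbius gyromidpoint b̄ = ū/(1 + √(1 − c‖ū‖²)). -/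
open RealInnerProductSpace

section KleinModel

variable {E : Type*} [SeminormedAddCommGroup E] [NormedSpace ℝ E]

/-- The Klein coordinate of a point `b` of the Poincaré ball satisfies
`1 - c‖n‖² = ((1 - c‖b‖²) / (1 + c‖b‖²))²`. -/
lemma one_sub_mul_norm_sq_klein {c : ℝ} (hc : 0 ≤ c) (b : E) :
    1 - c * ‖(2 / (1 + c * ‖b‖ ^ 2)) • b‖ ^ 2 =
      ((1 - c * ‖b‖ ^ 2) / (1 + c * ‖b‖ ^ 2)) ^ 2 := by
  have h : 1 + c * ‖b‖ ^ 2 ≠ 0 := by positivity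
  rw [norm_smul, mul_pow, Real.norm_eq_abs, sq_abs]
  field_simp
  ring

/-- The Lorentz factor of the Klein coordinate of `b` is the conformal factor at `b` minus one. -/
lemma lorentz_factor_klein {c : ℝ} (hc : 0 ≤ c) {b : E} (hb : c * ‖b‖ ^ 2 < 1) :
    1 / Real.sqrt (1 - c * ‖(2 / (1 + c * ‖b‖ ^ 2)) • b‖ ^ 2) =
      2 / (1 - c * ‖b‖ ^ 2) - 1 := by
  have h₁ : 0 < 1 + c * ‖b‖ ^ 2 := by positivity
  have h₂ : 0 < 1 - c * ‖b‖ ^ 2 := sub_pos.2 hb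
  rw [one_sub_mul_norm_sq_klein hc, Real.sqrt_sq (by positivity)]
  field_simp
  ring

lemma mul_norm_sq_klein_lt_one {c : ℝ} (hc : 0 ≤ c) {b : E} (hb : c * ‖b‖ ^ 2 < 1) :
    c * ‖(2 / (1 + c * ‖b‖ ^ 2)) • b‖ ^ 2 < 1 := by
  have h₁ : 0 < 1 + c * ‖b‖ ^ 2 := by positivity
  have h₂ : 0 < 1 - c * ‖b‖ ^ 2 := sub_pos.2 hb
  rw [← sub_pos, one_sub_mul_norm_sq_klein hc]
  positivity

lemma convex_setOf_mul_norm_sq_lt_one {c : ℝ} (hc : 0 ≤ c) :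
    Convex ℝ {x : E | c * ‖x‖ ^ 2 < 1} := by
  have h := ((convexOn_univ_norm (E := E)).pow (fun x _ => norm_nonneg x) 2).smul hc
  simpa using h.convex_lt 1

end KleinModel


open RealInnerProductSpace

/-- Theorem 1 (Möbius gyromidpoint = Einstein gyromidpoint): the Einstein gyromidpoint in
the Beltrami–Klein model, expressed in Poincaré coordinates, equals the vector `ū` defining
the Möbius gyromidpoint; hence its Klein-to-Poincaré projection is the Möbius gyromidpoint. -/
theorem einstein_eq_mobius_gyromidpoint {n N : ℕ} (c : ℝ) (hc : 0 < c)
    (b : Fin N → EuclideanSpace ℝ (Fin n)) (hb : ∀ i, c * ‖b i‖ ^ 2 < 1)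
    (ν : Fin N → ℝ) (hν : ∀ i, 0 ≤ ν i) (hsum : 0 < ∑ i, ν i)
    (nK : Fin N → EuclideanSpace ℝ (Fin n))
    (hnK : ∀ i, nK i = (2 / (1 + c * ‖b i‖ ^ 2)) • b i)
    (γ : Fin N → ℝ) (hγ : ∀ i, γ i = 1 / Real.sqrt (1 - c * ‖nK i‖ ^ 2))
    (nbar : EuclideanSpace ℝ (Fin n))
    (hnbar : nbar = (∑ i, ν i * γ i)⁻¹ • ∑ i, (ν i * γ i) • nK i)
    (ubar : EuclideanSpace ℝ (Fin n))
    (hubar : ubar = (∑ i, ν i * (2 / (1 - c * ‖b i‖ ^ 2) - 1))⁻¹ •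
        ∑ i, (ν i * (2 / (1 - c * ‖b i‖ ^ 2))) • b i) :
    nbar = ubar ∧ c * ‖ubar‖ ^ 2 < 1 ∧
    (1 / (1 + Real.sqrt (1 - c * ‖nbar‖ ^ 2))) • nbar =
      (1 / (1 + Real.sqrt (1 - c * ‖ubar‖ ^ 2))) • ubar := by
  have hγ' : ∀ i, γ i = 2 / (1 - c * ‖b i‖ ^ 2) - 1 := fun i => by
    rw [hγ, hnK, lorentz_factor_klein hc.le (hb i)]
  have hγ_one : ∀ i, 1 ≤ γ i := fun i => by
    have h₁ : 0 ≤ c * ‖b i‖ ^ 2 := by positivity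
    rw [hγ', le_sub_iff_add_le, le_div_iff₀ (sub_pos.2 (hb i))]
    linarith
  have hpos : 0 < ∑ i, ν i * γ i :=
    hsum.trans_le <| Finset.sum_le_sum fun i _ => le_mul_of_one_le_right (hν i) (hγ_one i)
  have heq : nbar = ubar := by
    rw [hnbar, hubar]
    simp only [← hγ']
    congr 1
    refine Finset.sum_congr rfl fun i _ => ?_
    have h₁ : 1 + c * ‖b i‖ ^ 2 ≠ 0 := by positivity
    have h₂ : 1 - c * ‖b i‖ ^ 2 ≠ 0 := (sub_pos.2 (hb i)).ne'
    rw [hnK, smul_smul, hγ']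
    congr 1
    field_simp
    ring
  have hball : c * ‖nbar‖ ^ 2 < 1 := by
    rw [hnbar]
    refine (convex_setOf_mul_norm_sq_lt_one hc.le).centerMass_mem
      (fun i _ => mul_nonneg (hν i) (zero_le_one.trans (hγ_one i))) hpos fun i _ => ?_
    rw [hnK]
    exact mul_norm_sq_klein_lt_one hc.le (hb i)
  exact ⟨heq, heq ▸ hball, by rw [heq]⟩
end

section
/- (Theorem 1, Möbius gyromidpoint = Lorentzian centroid.) Let c > 0, let b₁, …, b_N ∈ ℝⁿ satisfy c‖b_i‖² < 1, and let ν₁, …, ν_N be nonnegative reals with Σᵢ νᵢ > 0. Let hᵢ = h(bᵢ) be the hyperboloid images of the bᵢ and write (Z, K) = Σᵢ νᵢ hᵢ ∈ ℝ × ℝⁿ. Then Z² − ‖K‖² > 0, and the hyperboloid point h̄ = (Z̄, K̄) := (Z, K)/(√c·√(Z² − ‖K‖²)) (the centroid with respect to squared Lorentzian distance) projects onto the Poincaré ball as K̄/(1 + √c·Z̄) = b̄, the Möbius gyromidpoint of the bᵢ with weights νᵢ. -/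
/-- The isometric embedding of the Poincaré ball into the hyperboloid model. -/
noncomputable def toHyperboloid {n : ℕ} (c : ℝ) (b : EuclideanSpace ℝ (Fin n)) :
    ℝ × EuclideanSpace ℝ (Fin n) :=
  ((1 / Real.sqrt c) * ((1 + c * ‖b‖ ^ 2) / (1 - c * ‖b‖ ^ 2)),
    (2 / (1 - c * ‖b‖ ^ 2)) • b)

theorem norm_toHyperboloid_snd_lt_fst {n : ℕ} {c : ℝ} (hc : 0 < c)
    {b : EuclideanSpace ℝ (Fin n)} (hb : c * ‖b‖ ^ 2 < 1) :
    ‖(toHyperboloid c b).2‖ < (toHyperboloid c b).1 := by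
  have hs : 0 < √c := Real.sqrt_pos.2 hc
  have hs2 : √c ^ 2 = c := Real.sq_sqrt hc.le
  have hd : 0 < 1 - c * ‖b‖ ^ 2 := by linarith
  have hne : √c * ‖b‖ ≠ 1 := by
    intro h
    have : c * ‖b‖ ^ 2 = 1 := by rw [← hs2, ← mul_pow, h, one_pow]
    linarith
  have hsq : 0 < (√c * ‖b‖ - 1) ^ 2 := by
    have := sub_ne_zero.2 hne
    positivity
  have key : √c * (2 * ‖b‖) < 1 + c * ‖b‖ ^ 2 := by
    rw [sub_sq, mul_pow, hs2] at hsq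
    linarith
  simp only [toHyperboloid]
  rw [norm_smul, Real.norm_of_nonneg (by positivity), div_mul_eq_mul_div, div_mul_div_comm,
    one_mul, div_lt_div_iff₀ hd (by positivity)]
  linarith [mul_lt_mul_of_pos_right key hd]

theorem norm_sum_smul_lt_sum_mul {ι E : Type*} [SeminormedAddCommGroup E] [NormedSpace ℝ E]
    {s : Finset ι} {w t : ι → ℝ} {v : ι → E} (hw : ∀ i ∈ s, 0 ≤ w i)
    (hpos : 0 < ∑ i ∈ s, w i) (h : ∀ i ∈ s, ‖v i‖ < t i) :
    ‖∑ i ∈ s, w i • v i‖ < ∑ i ∈ s, w i * t i := by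
  obtain ⟨j, hj, hwj⟩ : ∃ j ∈ s, 0 < w j :=
    Finset.exists_lt_of_sum_lt (by rwa [Finset.sum_const_zero])
  calc ‖∑ i ∈ s, w i • v i‖ ≤ ∑ i ∈ s, w i * ‖v i‖ :=
        norm_sum_le_of_le s fun i hi ↦ by rw [norm_smul, Real.norm_of_nonneg (hw i hi)]
    _ < ∑ i ∈ s, w i * t i :=
        Finset.sum_lt_sum (fun i hi ↦ mul_le_mul_of_nonneg_left (h i hi).le (hw i hi))
          ⟨j, hj, mul_lt_mul_of_pos_left (h j hj) hwj⟩

/-- Theorem 1 (Möbius gyromidpoint = Lorentzian centroid): the centroid with respect to the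
squared Lorentzian distance in the hyperboloid model projects onto the Poincaré ball as the
Möbius gyromidpoint. -/
theorem lorentzian_centroid_eq_mobius_gyromidpoint {n N : ℕ} (c : ℝ) (hc : 0 < c)
    (b : Fin N → EuclideanSpace ℝ (Fin n)) (hb : ∀ i, c * ‖b i‖ ^ 2 < 1)
    (ν : Fin N → ℝ) (hν : ∀ i, 0 ≤ ν i) (hsum : 0 < ∑ i, ν i)
    (Z : ℝ) (hZ : Z = ∑ i, ν i * (toHyperboloid c (b i)).1)
    (K : EuclideanSpace ℝ (Fin n)) (hK : K = ∑ i, ν i • (toHyperboloid c (b i)).2)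
    (ubar : EuclideanSpace ℝ (Fin n))
    (hubar : ubar = (∑ i, ν i * (2 / (1 - c * ‖b i‖ ^ 2) - 1))⁻¹ •
        ∑ i, (ν i * (2 / (1 - c * ‖b i‖ ^ 2))) • b i)
    (bbar : EuclideanSpace ℝ (Fin n))
    (hbbar : bbar = (1 / (1 + Real.sqrt (1 - c * ‖ubar‖ ^ 2))) • ubar) :
    0 < Z ^ 2 - ‖K‖ ^ 2 ∧
    (1 / (1 + Real.sqrt c * (Z / (Real.sqrt c * Real.sqrt (Z ^ 2 - ‖K‖ ^ 2))))) •
      ((Real.sqrt c * Real.sqrt (Z ^ 2 - ‖K‖ ^ 2))⁻¹ • K) = bbar := by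
  have hs : 0 < √c := Real.sqrt_pos.2 hc
  have hKZ : ‖K‖ < Z := by
    rw [hK, hZ]
    exact norm_sum_smul_lt_sum_mul (fun i _ ↦ hν i) hsum
      fun i _ ↦ norm_toHyperboloid_snd_lt_fst hc (hb i)
  have hZpos : 0 < Z := (norm_nonneg K).trans_lt hKZ
  have hpos : 0 < Z ^ 2 - ‖K‖ ^ 2 :=
    sub_pos.2 (pow_lt_pow_left₀ hKZ (norm_nonneg K) two_ne_zero)
  refine ⟨hpos, ?_⟩
  have hW : ∑ i, ν i * (2 / (1 - c * ‖b i‖ ^ 2) - 1) = √c * Z := by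
    rw [hZ, Finset.mul_sum]
    refine Finset.sum_congr rfl fun i _ ↦ ?_
    have hd : 1 - c * ‖b i‖ ^ 2 ≠ 0 := (sub_pos.2 (hb i)).ne'
    simp only [toHyperboloid]
    field_simp
    ring
  have hu : ubar = (√c * Z)⁻¹ • K := by
    rw [hubar, hW, hK]
    simp only [toHyperboloid, smul_smul]
  have hnorm : 1 - c * ‖ubar‖ ^ 2 = (Z ^ 2 - ‖K‖ ^ 2) / Z ^ 2 := by
    rw [hu, norm_smul, Real.norm_of_nonneg (by positivity), mul_pow, inv_pow, mul_pow,
      Real.sq_sqrt hc.le]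
    field_simp
  have hD : 0 < √(Z ^ 2 - ‖K‖ ^ 2) := Real.sqrt_pos.2 hpos
  rw [hbbar, hnorm, Real.sqrt_div hpos.le, Real.sqrt_sq hZpos.le, hu, smul_smul, smul_smul]
  congr 1
  generalize √(Z ^ 2 - ‖K‖ ^ 2) = D at hD
  field_simp
  ring
end

section
/- (Möbius gyromidpoint as minimizer.) Let c > 0, let b₁, …, b_N ∈ ℝⁿ satisfy c‖b_i‖² < 1, and let ν₁, …, ν_N be nonnegative reals with Σᵢ νᵢ > 0. Define f(b̃) = Σᵢ νᵢ · λ^c_{(−b̃) ⊕_c bᵢ} · ‖(−b̃) ⊕_c bᵢ‖² for b̃ ∈ ℝⁿ with c‖b̃‖² < 1 (the weighted sum of calibrated squared gyrometrics). Then the Möbius gyromidpoint b̄ lies in the Poincaré ball and minimizes f: for every b̃ with c‖b̃‖² < 1, f(b̄) ≤ f(b̃). -/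
open RealInnerProductSpace

/-- Möbius addition on the Poincaré ball of curvature `-c`. -/
noncomputable def mobiusAdd {n : ℕ} (c : ℝ) (x y : EuclideanSpace ℝ (Fin n)) :
    EuclideanSpace ℝ (Fin n) :=
  (1 / (1 + 2 * c * ⟪x, y⟫ + c ^ 2 * ‖x‖ ^ 2 * ‖y‖ ^ 2)) •
    ((1 + 2 * c * ⟪x, y⟫ + c * ‖y‖ ^ 2) • x + (1 - c * ‖x‖ ^ 2) • y)

/-- The conformal factor of the Poincaré ball of curvature `-c`. -/
noncomputable def confFactor {n : ℕ} (c : ℝ) (x : EuclideanSpace ℝ (Fin n)) : ℝ :=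
  2 / (1 - c * ‖x‖ ^ 2)

/-- The norm identity for gyrodifferences in the Poincaré ball. -/
theorem norm_mobiusAdd_neg_sq {n : ℕ} {c : ℝ} (x y : EuclideanSpace ℝ (Fin n))
    (h : 1 - 2 * c * ⟪x, y⟫ + c ^ 2 * ‖x‖ ^ 2 * ‖y‖ ^ 2 ≠ 0) :
    ‖mobiusAdd c (-x) y‖ ^ 2 =
      ‖x - y‖ ^ 2 / (1 - 2 * c * ⟪x, y⟫ + c ^ 2 * ‖x‖ ^ 2 * ‖y‖ ^ 2) := by
  have key : ‖(1 - 2 * c * ⟪x, y⟫ + c * ‖y‖ ^ 2) • (-x) + (1 - c * ‖x‖ ^ 2) • y‖ ^ 2 =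
      ‖x - y‖ ^ 2 * (1 - 2 * c * ⟪x, y⟫ + c ^ 2 * ‖x‖ ^ 2 * ‖y‖ ^ 2) := by
    rw [norm_add_sq_real, norm_sub_sq_real, norm_smul, norm_smul, mul_pow, mul_pow,
      inner_smul_left, inner_smul_right, inner_neg_left, norm_neg, Real.norm_eq_abs,
      Real.norm_eq_abs, sq_abs, sq_abs]
    simp only [conj_trivial]
    ring
  have hm : mobiusAdd c (-x) y =
      (1 / (1 - 2 * c * ⟪x, y⟫ + c ^ 2 * ‖x‖ ^ 2 * ‖y‖ ^ 2)) •
        ((1 - 2 * c * ⟪x, y⟫ + c * ‖y‖ ^ 2) • (-x) + (1 - c * ‖x‖ ^ 2) • y) := by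
    simp only [mobiusAdd, inner_neg_left, norm_neg, mul_neg, ← sub_eq_add_neg]
  rw [hm, norm_smul, mul_pow, key, Real.norm_eq_abs, sq_abs]
  field_simp

/-- The calibrated squared gyrometric in terms of Euclidean data. -/
theorem confFactor_mul_norm_mobiusAdd_neg_sq {n : ℕ} {c : ℝ} (hc : 0 < c)
    {x y : EuclideanSpace ℝ (Fin n)} (hx : c * ‖x‖ ^ 2 < 1) (hy : c * ‖y‖ ^ 2 < 1) :
    confFactor c (mobiusAdd c (-x) y) * ‖mobiusAdd c (-x) y‖ ^ 2 =
      confFactor c y * ‖x - y‖ ^ 2 / (1 - c * ‖x‖ ^ 2) := by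
  have hD : 1 - 2 * c * ⟪x, y⟫ + c ^ 2 * ‖x‖ ^ 2 * ‖y‖ ^ 2 =
      (1 - c * ‖x‖ ^ 2) * (1 - c * ‖y‖ ^ 2) + c * ‖x - y‖ ^ 2 := by
    rw [norm_sub_sq_real]; ring
  have hx' : 0 < 1 - c * ‖x‖ ^ 2 := by linarith
  have hy' : 0 < 1 - c * ‖y‖ ^ 2 := by linarith
  have hpos : 0 < (1 - c * ‖x‖ ^ 2) * (1 - c * ‖y‖ ^ 2) + c * ‖x - y‖ ^ 2 := by positivity
  rw [confFactor, confFactor, norm_mobiusAdd_neg_sq x y (by rw [hD]; exact hpos.ne'), hD]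
  have h1 : 1 - c * (‖x - y‖ ^ 2 /
      ((1 - c * ‖x‖ ^ 2) * (1 - c * ‖y‖ ^ 2) + c * ‖x - y‖ ^ 2)) =
      (1 - c * ‖x‖ ^ 2) * (1 - c * ‖y‖ ^ 2) /
        ((1 - c * ‖x‖ ^ 2) * (1 - c * ‖y‖ ^ 2) + c * ‖x - y‖ ^ 2) := by
    rw [eq_div_iff hpos.ne', sub_mul, mul_assoc, div_mul_cancel₀ _ hpos.ne']
    ring
  rw [h1]
  generalize (1 - c * ‖x‖ ^ 2) * (1 - c * ‖y‖ ^ 2) + c * ‖x - y‖ ^ 2 = D at hpos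
  field_simp

theorem confFactor_pos {n : ℕ} {c : ℝ} {x : EuclideanSpace ℝ (Fin n)}
    (hx : c * ‖x‖ ^ 2 < 1) : 0 < confFactor c x :=
  div_pos two_pos (by linarith)

theorem mul_confFactor_mul_norm_sq {n : ℕ} {c : ℝ} {x : EuclideanSpace ℝ (Fin n)}
    (hx : c * ‖x‖ ^ 2 < 1) : c * (confFactor c x * ‖x‖ ^ 2) = confFactor c x - 2 := by
  have hx' : 1 - c * ‖x‖ ^ 2 ≠ 0 := by linarith
  rw [confFactor]
  field_simp
  ring

theorem sqrt_mul_confFactor_mul_norm_lt {n : ℕ} {c : ℝ} (hc : 0 < c)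
    {x : EuclideanSpace ℝ (Fin n)} (hx : c * ‖x‖ ^ 2 < 1) :
    √c * (confFactor c x * ‖x‖) < confFactor c x - 1 := by
  have hs : √c ^ 2 = c := Real.sq_sqrt hc.le
  have ht : √c * ‖x‖ < 1 := by
    by_contra! h
    nlinarith
  have h1 := mul_confFactor_mul_norm_sq hx
  have h2 : 0 < confFactor c x * (1 - √c * ‖x‖) ^ 2 :=
    mul_pos (confFactor_pos hx) (pow_pos (by linarith) 2)
  have h3 : confFactor c x * (1 - √c * ‖x‖) ^ 2 = confFactor c x
      - 2 * (√c * (confFactor c x * ‖x‖)) + √c ^ 2 * (confFactor c x * ‖x‖ ^ 2) := by ring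
  rw [hs, h1] at h3
  linarith

/-- The weighted sum of calibrated squared gyrometrics as a function of the base point. -/
theorem mul_sum_confFactor_mul_norm_mobiusAdd_neg_sq {n N : ℕ} {c : ℝ} (hc : 0 < c)
    {b : Fin N → EuclideanSpace ℝ (Fin n)} (hb : ∀ i, c * ‖b i‖ ^ 2 < 1) (ν : Fin N → ℝ)
    {x : EuclideanSpace ℝ (Fin n)} (hx : c * ‖x‖ ^ 2 < 1) :
    c * ∑ i, ν i * confFactor c (mobiusAdd c (-x) (b i)) * ‖mobiusAdd c (-x) (b i)‖ ^ 2 =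
      2 * ((∑ i, ν i * (confFactor c (b i) - 1)) -
        c * ⟪x, ∑ i, (ν i * confFactor c (b i)) • b i⟫) / (1 - c * ‖x‖ ^ 2) -
        ∑ i, ν i * confFactor c (b i) := by
  have hx' : 1 - c * ‖x‖ ^ 2 ≠ 0 := by linarith
  simp only [inner_sum, inner_smul_right, Finset.mul_sum, ← Finset.sum_sub_distrib,
    Finset.sum_div]
  refine Finset.sum_congr rfl fun i _ => ?_
  rw [mul_assoc, confFactor_mul_norm_mobiusAdd_neg_sq hc hx (hb i), norm_sub_sq_real]
  have h := mul_confFactor_mul_norm_sq (hb i)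
  rw [eq_sub_iff_add_eq, eq_div_iff hx', add_mul, mul_div_assoc', mul_div_assoc',
    div_mul_cancel₀ _ hx']
  linear_combination ν i * h

theorem mul_norm_smul_sum_sq_lt_one {n N : ℕ} {c : ℝ} (hc : 0 < c)
    {b : Fin N → EuclideanSpace ℝ (Fin n)} (hb : ∀ i, c * ‖b i‖ ^ 2 < 1)
    {ν : Fin N → ℝ} (hν : ∀ i, 0 ≤ ν i) (hsum : 0 < ∑ i, ν i) :
    0 < ∑ i, ν i * (confFactor c (b i) - 1) ∧
    c * ‖(∑ i, ν i * (confFactor c (b i) - 1))⁻¹ •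
      ∑ i, (ν i * confFactor c (b i)) • b i‖ ^ 2 < 1 := by
  obtain ⟨j, hj, hjpos⟩ : ∃ j ∈ Finset.univ, 0 < ν j := by
    by_contra! h
    exact hsum.not_ge (Finset.sum_nonpos h)
  have hlt : √c * ‖∑ i, (ν i * confFactor c (b i)) • b i‖ <
      ∑ i, ν i * (confFactor c (b i) - 1) := by
    calc √c * ‖∑ i, (ν i * confFactor c (b i)) • b i‖
        ≤ √c * ∑ i, ‖(ν i * confFactor c (b i)) • b i‖ := by
          gcongr
          exact norm_sum_le _ _
      _ = ∑ i, ν i * (√c * (confFactor c (b i) * ‖b i‖)) := by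
          rw [Finset.mul_sum]
          refine Finset.sum_congr rfl fun i _ => ?_
          rw [norm_smul, Real.norm_of_nonneg (mul_nonneg (hν i) (confFactor_pos (hb i)).le)]
          ring
      _ < ∑ i, ν i * (confFactor c (b i) - 1) :=
          Finset.sum_lt_sum
            (fun i _ => mul_le_mul_of_nonneg_left
              (sqrt_mul_confFactor_mul_norm_lt hc (hb i)).le (hν i))
            ⟨j, hj, mul_lt_mul_of_pos_left (sqrt_mul_confFactor_mul_norm_lt hc (hb j)) hjpos⟩
  have hW : 0 < ∑ i, ν i * (confFactor c (b i) - 1) := lt_of_le_of_lt (by positivity) hlt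
  refine ⟨hW, ?_⟩
  rw [norm_smul, norm_inv, Real.norm_of_nonneg hW.le, mul_pow, inv_pow, mul_left_comm,
    inv_mul_lt_one₀ (by positivity)]
  calc c * ‖∑ i, (ν i * confFactor c (b i)) • b i‖ ^ 2
      = (√c * ‖∑ i, (ν i * confFactor c (b i)) • b i‖) ^ 2 := by
        rw [mul_pow, Real.sq_sqrt hc.le]
    _ < _ := by gcongr

/-- The Möbius gyromidpoint lies in the Poincaré ball and minimizes the weighted sum of
calibrated squared gyrometrics. -/
theorem mobius_gyromidpoint_minimizes {n N : ℕ} (c : ℝ) (hc : 0 < c)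
    (b : Fin N → EuclideanSpace ℝ (Fin n)) (hb : ∀ i, c * ‖b i‖ ^ 2 < 1)
    (ν : Fin N → ℝ) (hν : ∀ i, 0 ≤ ν i) (hsum : 0 < ∑ i, ν i)
    (ubar : EuclideanSpace ℝ (Fin n))
    (hubar : ubar = (∑ i, ν i * (confFactor c (b i) - 1))⁻¹ •
        ∑ i, (ν i * confFactor c (b i)) • b i)
    (bbar : EuclideanSpace ℝ (Fin n))
    (hbbar : bbar = (1 / (1 + Real.sqrt (1 - c * ‖ubar‖ ^ 2))) • ubar) :
    c * ‖bbar‖ ^ 2 < 1 ∧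
    ∀ bt : EuclideanSpace ℝ (Fin n), c * ‖bt‖ ^ 2 < 1 →
      ∑ i, ν i * confFactor c (mobiusAdd c (-bbar) (b i)) *
          ‖mobiusAdd c (-bbar) (b i)‖ ^ 2 ≤
      ∑ i, ν i * confFactor c (mobiusAdd c (-bt) (b i)) *
          ‖mobiusAdd c (-bt) (b i)‖ ^ 2 := by
  obtain ⟨hW, hu⟩ := mul_norm_smul_sum_sq_lt_one hc hb hν hsum
  rw [← hubar] at hu
  have hV : ∑ i, (ν i * confFactor c (b i)) • b i =
      (∑ i, ν i * (confFactor c (b i) - 1)) • ubar := by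
    rw [hubar, smul_inv_smul₀ hW.ne']
  set r := √(1 - c * ‖ubar‖ ^ 2) with hr
  have hr0 : 0 < r := Real.sqrt_pos.2 (by linarith)
  have hr2 : r ^ 2 = 1 - c * ‖ubar‖ ^ 2 := Real.sq_sqrt (by linarith)
  have hub : ubar = (1 + r) • bbar := by
    rw [hbbar, smul_smul, mul_one_div_cancel (by positivity), one_smul]
  have hbn : (1 + r) * (c * ‖bbar‖ ^ 2) = 1 - r := by
    rw [hub, norm_smul, Real.norm_of_nonneg (by positivity)] at hr2
    refine mul_left_cancel₀ (show 1 + r ≠ 0 by positivity) ?_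
    linear_combination hr2
  have hball : c * ‖bbar‖ ^ 2 < 1 := by nlinarith
  refine ⟨hball, fun bt hbt => le_of_mul_le_mul_left ?_ hc⟩
  rw [mul_sum_confFactor_mul_norm_mobiusAdd_neg_sq hc hb ν hball,
    mul_sum_confFactor_mul_norm_mobiusAdd_neg_sq hc hb ν hbt, hV, hub]
  simp only [inner_smul_right, real_inner_self_eq_norm_sq]
  generalize ∑ i, ν i * (confFactor c (b i) - 1) = W at hW
  have hleft : 2 * (W - c * (W * ((1 + r) * ‖bbar‖ ^ 2))) / (1 - c * ‖bbar‖ ^ 2) =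
      W * (1 + r) := by
    rw [div_eq_iff (by linarith)]
    linear_combination -W * hbn
  rw [hleft]
  refine sub_le_sub_right ((le_div_iff₀ (by linarith)).2 ?_) _
  have hsq : 0 ≤ W * ((1 + r) * (c * ‖bt - bbar‖ ^ 2)) := by positivity
  rw [norm_sub_sq_real] at hsq
  linear_combination hsq + W * hbn
end

section
/- (Closed form of the unidirectional Poincaré MLR score.) Let c > 0, let x ∈ ℝⁿ satisfy c‖x‖² < 1, let z ∈ ℝⁿ be nonzero, and let r ∈ ℝ. Set ẑ = z/‖z‖, q = (1/√c)·tanh(√c·r)·ẑ, a = sech²(√c·r)·z, and u = (−q) ⊕_c x. Then (2‖a‖ / (√c·(1 − c‖q‖²))) · arsinh( 2√c·⟨u, a⟩ / ((1 − c‖u‖²)·‖a‖) ) = (2‖z‖/√c) · arsinh( (2√c·⟨x, ẑ⟩/(1 − c‖x‖²))·cosh(2√c·r) − ((1 + c‖x‖²)/(1 − c‖x‖²))·sinh(2√c·r) ). -/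
open RealInnerProductSpace

theorem mobiusAdd_denom_pos {n : ℕ} {c : ℝ} (hc : 0 < c) {x y : EuclideanSpace ℝ (Fin n)}
    (hx : c * ‖x‖ ^ 2 < 1) (hy : c * ‖y‖ ^ 2 < 1) :
    0 < 1 + 2 * c * ⟪x, y⟫ + c ^ 2 * ‖x‖ ^ 2 * ‖y‖ ^ 2 := by
  have hinner : -(‖x‖ * ‖y‖) ≤ ⟪x, y⟫ := (abs_le.mp (abs_real_inner_le_norm x y)).1
  have hlt : c * (‖x‖ * ‖y‖) < 1 := by
    nlinarith [mul_nonneg hc.le (sq_nonneg (‖x‖ - ‖y‖))]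
  nlinarith [mul_le_mul_of_nonneg_left hinner hc.le, pow_pos (sub_pos.mpr hlt) 2]

theorem one_sub_mul_norm_mobiusAdd_sq {n : ℕ} {c : ℝ} {x y : EuclideanSpace ℝ (Fin n)}
    (hD : 1 + 2 * c * ⟪x, y⟫ + c ^ 2 * ‖x‖ ^ 2 * ‖y‖ ^ 2 ≠ 0) :
    1 - c * ‖mobiusAdd c x y‖ ^ 2 = (1 - c * ‖x‖ ^ 2) * (1 - c * ‖y‖ ^ 2) /
      (1 + 2 * c * ⟪x, y⟫ + c ^ 2 * ‖x‖ ^ 2 * ‖y‖ ^ 2) := by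
  rw [mobiusAdd, norm_smul, mul_pow, norm_add_sq_real, norm_smul, norm_smul, real_inner_smul_left,
    real_inner_smul_right, mul_pow, mul_pow]
  simp only [Real.norm_eq_abs, sq_abs]
  generalize hDdef : 1 + 2 * c * ⟪x, y⟫ + c ^ 2 * ‖x‖ ^ 2 * ‖y‖ ^ 2 = D at hD ⊢
  field_simp
  subst hDdef
  ring

/-- Closed form of the unidirectional Poincaré MLR score. -/
theorem unidirectional_poincare_mlr_closed_form {n : ℕ} (c : ℝ) (hc : 0 < c)
    (x z : EuclideanSpace ℝ (Fin n)) (hx : c * ‖x‖ ^ 2 < 1) (hz : z ≠ 0) (r : ℝ)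
    (zhat : EuclideanSpace ℝ (Fin n)) (hzhat : zhat = ‖z‖⁻¹ • z)
    (q : EuclideanSpace ℝ (Fin n))
    (hq : q = ((1 / Real.sqrt c) * Real.tanh (Real.sqrt c * r)) • zhat)
    (a : EuclideanSpace ℝ (Fin n))
    (ha : a = ((1 / Real.cosh (Real.sqrt c * r)) ^ 2) • z)
    (u : EuclideanSpace ℝ (Fin n)) (hu : u = mobiusAdd c (-q) x) :
    (2 * ‖a‖ / (Real.sqrt c * (1 - c * ‖q‖ ^ 2))) *
        Real.arsinh (2 * Real.sqrt c * ⟪u, a⟫ / ((1 - c * ‖u‖ ^ 2) * ‖a‖)) =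
      (2 * ‖z‖ / Real.sqrt c) *
        Real.arsinh ((2 * Real.sqrt c * ⟪x, zhat⟫ / (1 - c * ‖x‖ ^ 2)) *
            Real.cosh (2 * Real.sqrt c * r) -
          ((1 + c * ‖x‖ ^ 2) / (1 - c * ‖x‖ ^ 2)) * Real.sinh (2 * Real.sqrt c * r)) := by
  have hs : 0 < √c := Real.sqrt_pos.mpr hc
  have hs2 : √c ^ 2 = c := Real.sq_sqrt hc.le
  have hC : 0 < Real.cosh (√c * r) := Real.cosh_pos _
  have hCS : Real.cosh (√c * r) ^ 2 = Real.sinh (√c * r) ^ 2 + 1 := Real.cosh_sq _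
  have hz' : 0 < ‖z‖ := norm_pos_iff.mpr hz
  have hzz : z = ‖z‖ • zhat := by rw [hzhat, smul_inv_smul₀ hz'.ne']
  have hnorm : ‖zhat‖ = 1 := by
    rw [hzhat, norm_smul, norm_inv, norm_norm, inv_mul_cancel₀ hz'.ne']
  have hna : ‖a‖ = ‖z‖ / Real.cosh (√c * r) ^ 2 := by
    rw [ha, norm_smul, Real.norm_of_nonneg (by positivity)]
    ring
  have hq2 : c * ‖q‖ ^ 2 = Real.tanh (√c * r) ^ 2 := by
    rw [hq, norm_smul, hnorm, mul_one, Real.norm_eq_abs, sq_abs, mul_pow, div_pow, hs2]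
    field_simp
  have hq1 : 1 - c * ‖q‖ ^ 2 = 1 / Real.cosh (√c * r) ^ 2 := by
    rw [hq2, Real.tanh_eq_sinh_div_cosh]
    field_simp
    linarith
  have hqlt : c * ‖-q‖ ^ 2 < 1 := by
    have : 0 < 1 - c * ‖q‖ ^ 2 := hq1 ▸ by positivity
    rw [norm_neg]
    linarith
  have hD := (mobiusAdd_denom_pos hc hqlt hx).ne'
  have hu1 := one_sub_mul_norm_mobiusAdd_sq hD
  have hX : 1 - c * ‖x‖ ^ 2 ≠ 0 := by linarith
  have hua : ⟪u, a⟫ = ‖a‖ * ⟪u, zhat⟫ := by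
    rw [hna, ha, real_inner_smul_right]
    nth_rw 1 [hzz]
    rw [real_inner_smul_right]
    ring
  have hqz : ⟪-q, zhat⟫ = -(Real.tanh (√c * r) / √c) := by
    rw [inner_neg_left, hq, real_inner_smul_left, real_inner_self_eq_norm_sq, hnorm]
    ring
  have hqx : c * ⟪-q, x⟫ = -(√c * Real.tanh (√c * r) * ⟪x, zhat⟫) := by
    rw [inner_neg_left, hq, real_inner_smul_left, real_inner_comm]
    nth_rw 1 [← hs2]
    field_simp
  have harg : 2 * √c * ⟪u, a⟫ / ((1 - c * ‖u‖ ^ 2) * ‖a‖) =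
      (2 * √c * ⟪x, zhat⟫ / (1 - c * ‖x‖ ^ 2)) * Real.cosh (2 * √c * r) -
        ((1 + c * ‖x‖ ^ 2) / (1 - c * ‖x‖ ^ 2)) * Real.sinh (2 * √c * r) := by
    have ha0 : ‖a‖ ≠ 0 := by rw [hna]; positivity
    rw [hua, hu, hu1, mul_assoc 2 √c r, Real.cosh_two_mul, Real.sinh_two_mul, mobiusAdd,
      real_inner_smul_left, inner_add_left, real_inner_smul_left, real_inner_smul_left,
      hqz, norm_neg, hq1, mul_assoc 2 c, hqx, Real.tanh_eq_sinh_div_cosh]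
    rw [norm_neg, mul_assoc 2 c, hqx, Real.tanh_eq_sinh_div_cosh] at hD
    generalize 1 + 2 * -(√c * (Real.sinh (√c * r) / Real.cosh (√c * r)) * ⟪x, zhat⟫) +
      c ^ 2 * ‖q‖ ^ 2 * ‖x‖ ^ 2 = D at hD ⊢
    field_simp
    rw [hCS]
    ring
  rw [harg, hq1, hna]
  congr 1
  field_simp
end

section
/- (Euclidean limit of the unidirectional Poincaré MLR.) Let x ∈ ℝⁿ, let z ∈ ℝⁿ be nonzero, and let r ∈ ℝ. Define for c > 0 (with c small enough that c‖x‖² < 1) the function v_c(x) = (2‖z‖/√c) · arsinh( (2√c·⟨x, z/‖z‖⟩/(1 − c‖x‖²))·cosh(2√c·r) − ((1 + c‖x‖²)/(1 − c‖x‖²))·sinh(2√c·r) ). Then lim_{c → 0⁺} v_c(x) = 4(⟨x, z⟩ − r‖z‖). -/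
open RealInnerProductSpace

/-- The derivative at `0` of the Poincaré MLR score, as a function of the square root `s` of the
curvature. -/
theorem hasDerivAt_arsinh_poincare_score (a b r : ℝ) :
    HasDerivAt (fun s : ℝ => Real.arsinh ((2 * s * a / (1 - s ^ 2 * b)) * Real.cosh (2 * s * r) -
      ((1 + s ^ 2 * b) / (1 - s ^ 2 * b)) * Real.sinh (2 * s * r))) (2 * (a - r)) 0 := by
  have hlin (t : ℝ) : HasDerivAt (fun s : ℝ => 2 * s * t) (2 * t) 0 := by
    simpa using ((hasDerivAt_id (0 : ℝ)).const_mul 2).mul_const t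
  have hsq : HasDerivAt (fun s : ℝ => s ^ 2 * b) 0 0 := by
    simpa using (hasDerivAt_pow 2 (0 : ℝ)).mul_const b
  have hden : (1 : ℝ) - 0 ^ 2 * b ≠ 0 := by simp
  have h := ((((hlin a).div (hsq.const_sub 1) hden).mul (hlin r).cosh).sub
    (((hsq.const_add 1).div (hsq.const_sub 1) hden).mul (hlin r).sinh)).arsinh
  refine h.congr_deriv ?_
  simp
  ring

/-- Euclidean limit of the unidirectional Poincaré MLR score as the curvature tends to zero
from the right. -/
theorem unidirectional_poincare_mlr_euclidean_limit {n : ℕ}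
    (x z : EuclideanSpace ℝ (Fin n)) (hz : z ≠ 0) (r : ℝ) :
    Filter.Tendsto (fun c : ℝ =>
        (2 * ‖z‖ / Real.sqrt c) *
          Real.arsinh ((2 * Real.sqrt c * ⟪x, ‖z‖⁻¹ • z⟫ / (1 - c * ‖x‖ ^ 2)) *
              Real.cosh (2 * Real.sqrt c * r) -
            ((1 + c * ‖x‖ ^ 2) / (1 - c * ‖x‖ ^ 2)) * Real.sinh (2 * Real.sqrt c * r)))
      (nhdsWithin 0 (Set.Ioi 0)) (nhds (4 * (⟪x, z⟫ - r * ‖z‖))) := by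
  have hz' : ‖z‖ ≠ 0 := norm_ne_zero_iff.mpr hz
  have hsqrt : Filter.Tendsto Real.sqrt (nhdsWithin 0 (Set.Ioi 0)) (nhdsWithin 0 {0}ᶜ) := by
    refine tendsto_nhdsWithin_iff.mpr ⟨?_, ?_⟩
    · simpa using (Real.continuous_sqrt.tendsto 0).mono_left nhdsWithin_le_nhds
    · filter_upwards [self_mem_nhdsWithin] with c hc
      exact (Real.sqrt_pos.mpr hc).ne'
  have hslope := ((hasDerivAt_arsinh_poincare_score ⟪x, ‖z‖⁻¹ • z⟫ (‖x‖ ^ 2) r).tendsto_slope.comp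
    hsqrt).const_mul (2 * ‖z‖)
  have hlim : 2 * ‖z‖ * (2 * (⟪x, ‖z‖⁻¹ • z⟫ - r)) = 4 * (⟪x, z⟫ - r * ‖z‖) := by
    rw [real_inner_smul_right]
    field_simp
    ring
  rw [hlim] at hslope
  refine hslope.congr' ?_
  filter_upwards [self_mem_nhdsWithin] with c hc
  simp [slope_def_field, Real.sq_sqrt (le_of_lt hc)]
  ring
end

section
/- (Poincaré FC layer output.) Let c > 0, let m ≥ 1, let w ∈ ℝᵐ, and define y = w/(1 + √(1 + c‖w‖²)). Then c‖y‖² < 1, with 1 − c‖y‖² = 2/(1 + √(1 + c‖w‖²)), and for every coordinate index k one has 2·y_k/(1 − c‖y‖²) = w_k; hence the signed distance (1/√c)·arsinh(2√c·y_k/(1 − c‖y‖²)) from y to the Poincaré hyperplane orthogonal to the k-th axis through the origin equals (1/√c)·arsinh(√c·w_k). -/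
/-- Properties of the Poincaré FC layer output `y = w / (1 + √(1 + c‖w‖²))`. -/
theorem poincare_fc_layer_output (c : ℝ) (hc : 0 < c) (m : ℕ) (hm : 1 ≤ m)
    (w : EuclideanSpace ℝ (Fin m)) (y : EuclideanSpace ℝ (Fin m))
    (hy : y = (1 / (1 + Real.sqrt (1 + c * ‖w‖ ^ 2))) • w) :
    c * ‖y‖ ^ 2 < 1 ∧
    1 - c * ‖y‖ ^ 2 = 2 / (1 + Real.sqrt (1 + c * ‖w‖ ^ 2)) ∧
    (∀ k : Fin m, 2 * y k / (1 - c * ‖y‖ ^ 2) = w k) ∧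
    (∀ k : Fin m,
      (1 / Real.sqrt c) * Real.arsinh (2 * Real.sqrt c * y k / (1 - c * ‖y‖ ^ 2)) =
        (1 / Real.sqrt c) * Real.arsinh (Real.sqrt c * w k)) := by
  have hs : Real.sqrt (1 + c * ‖w‖ ^ 2) ^ 2 = 1 + c * ‖w‖ ^ 2 := Real.sq_sqrt (by positivity)
  have hs0 : 0 ≤ Real.sqrt (1 + c * ‖w‖ ^ 2) := Real.sqrt_nonneg _
  have hcoord : ∀ k : Fin m, y k = w k / (1 + Real.sqrt (1 + c * ‖w‖ ^ 2)) := by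
    intro k
    rw [hy, PiLp.smul_apply, smul_eq_mul]
    ring
  have hnorm : ‖y‖ = ‖w‖ / (1 + Real.sqrt (1 + c * ‖w‖ ^ 2)) := by
    rw [hy, norm_smul, Real.norm_of_nonneg (by positivity)]
    ring
  generalize Real.sqrt (1 + c * ‖w‖ ^ 2) = s at *
  have hpos : 0 < 1 + s := by positivity
  have hgap : 1 - c * ‖y‖ ^ 2 = 2 / (1 + s) := by
    rw [hnorm]
    field_simp
    linear_combination hs
  have hgap_pos : 0 < 1 - c * ‖y‖ ^ 2 := by
    rw [hgap]
    positivity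
  have hratio : ∀ k : Fin m, 2 * y k / (1 - c * ‖y‖ ^ 2) = w k := by
    intro k
    rw [hgap, hcoord]
    field_simp
  refine ⟨by linarith, hgap, hratio, fun k => ?_⟩
  rw [← hratio k]
  congr 2
  ring
end

section
/- (Uniqueness of the Poincaré FC layer output.) Let c > 0, let m ≥ 1, and let w ∈ ℝᵐ. If y′ ∈ ℝᵐ satisfies c‖y′‖² < 1 and y′_k = ((1 − c‖y′‖²)/2)·w_k for every coordinate index k, then y′ = w/(1 + √(1 + c‖w‖²)). In particular, y = w/(1 + √(1 + c‖w‖²)) is the unique point of the Poincaré ball satisfying this system of equations. -/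
/-- Uniqueness of the Poincaré FC layer output: any point of the Poincaré ball solving the
coordinate system equals `w / (1 + √(1 + c‖w‖²))`. -/
theorem poincare_fc_layer_output_unique (c : ℝ) (hc : 0 < c) (m : ℕ) (hm : 1 ≤ m)
    (w y' : EuclideanSpace ℝ (Fin m)) (h1 : c * ‖y'‖ ^ 2 < 1)
    (h2 : ∀ k : Fin m, y' k = ((1 - c * ‖y'‖ ^ 2) / 2) * w k) :
    y' = (1 / (1 + Real.sqrt (1 + c * ‖w‖ ^ 2))) • w := by
  obtain ⟨t, ht⟩ : ∃ t, t = (1 - c * ‖y'‖ ^ 2) / 2 := ⟨_, rfl⟩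
  have hy : y' = t • w := by
    ext k
    simpa [ht] using h2 k
  have hnorm : ‖y'‖ ^ 2 = t ^ 2 * ‖w‖ ^ 2 := by
    rw [hy, norm_smul, mul_pow, Real.norm_eq_abs, sq_abs]
  have ht_pos : 0 < t := by linarith
  have ht_le : t ≤ 1 / 2 := by
    have : 0 ≤ c * ‖y'‖ ^ 2 := by positivity
    linarith
  have hs_nonneg := Real.sqrt_nonneg (1 + c * ‖w‖ ^ 2)
  have hs_sq : Real.sqrt (1 + c * ‖w‖ ^ 2) ^ 2 = 1 + c * ‖w‖ ^ 2 :=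
    Real.sq_sqrt (by positivity)
  have hts : t * Real.sqrt (1 + c * ‖w‖ ^ 2) = 1 - t := by
    refine (sq_eq_sq₀ (by positivity) (by linarith)).mp ?_
    rw [mul_pow, hs_sq]
    rw [hnorm] at ht
    linear_combination 2 * ht
  have ht_eq : t = 1 / (1 + Real.sqrt (1 + c * ‖w‖ ^ 2)) := by
    rw [eq_div_iff (by positivity)]
    linarith
  rw [← ht_eq, hy]
end
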